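/- Let μ, ν be compactly supported, atomless Borel probability measures on ℝ, λ_C := W∞(μ,ν), γ̄ an ∞-cyclically monotone optimal plan, and γ any optimal plan. Then the restriction γ⌊(M_γ̄^+ × ℝ) is concentrated on the line {(x,y) : y = x + λ_C}, and the restriction γ⌊(M_γ̄^- × ℝ) is concentrated on the line {(x,y) : y = x − λ_C}. In particular every optimal plan coincides on M_γ̄^+ (resp. M_γ̄^-) with the translation by +λ_C (resp. −λ_C). -/

import Mathlib

open MeasureTheory Set Filter Topology
open scoped ENNReal NNReal

noncomputable section

/-- Topological support of a measure: points all of whose open neighborhoods have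
positive measure. -/
def mSupport {α : Type*} [TopologicalSpace α] [MeasurableSpace α] (γ : Measure α) : Set α :=
  {x | ∀ U : Set α, IsOpen U → x ∈ U → 0 < γ U}

/-- γ is a transport plan (coupling) between μ and ν. -/
def IsCoupling {α : Type*} [MeasurableSpace α] (μ ν : Measure α) (γ : Measure (α × α)) : Prop :=
  γ.fst = μ ∧ γ.snd = ν

/-- The γ-essential supremum of the distance |x - y|. -/
def costInf {α : Type*} [MeasurableSpace α] [PseudoEMetricSpace α]
    (γ : Measure (α × α)) : ℝ≥0∞ :=
  essSup (fun p => edist p.1 p.2) γ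

/-- The L^∞ optimal transport cost W∞(μ, ν). -/
def Winfty {α : Type*} [MeasurableSpace α] [PseudoEMetricSpace α] (μ ν : Measure α) : ℝ≥0∞ :=
  ⨅ (γ : Measure (α × α)) (_ : IsCoupling μ ν γ), costInf γ

/-- γ is an optimal plan for the L^∞ optimal transport problem. -/
def IsOptimalPlan {α : Type*} [MeasurableSpace α] [PseudoEMetricSpace α]
    (μ ν : Measure α) (γ : Measure (α × α)) : Prop :=
  IsCoupling μ ν γ ∧ costInf γ = Winfty μ ν

/-- μ is compactly supported. -/
def CompactlySupported {α : Type*} [TopologicalSpace α] [MeasurableSpace α]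
    (μ : Measure α) : Prop :=
  ∃ K : Set α, IsCompact K ∧ μ Kᶜ = 0

/-- The admissible class U_λ of the dual problem. -/
def DualAdm {α : Type*} [MeasurableSpace α] [PseudoMetricSpace α]
    (μ ν : Measure α) (lam : ℝ) (φ ψ : α → ℝ) : Prop :=
  Integrable φ μ ∧ Integrable ψ ν ∧
    ∀ᵐ x ∂μ, ∀ᵐ y ∂ν, dist x y ≤ lam → φ x + ψ y ≤ 0

/-- ∞-cyclical monotonicity of a plan on ℝ. -/
def InfCM (γ : Measure (ℝ × ℝ)) : Prop :=
  ∀ (n : ℕ) (p : Fin (n + 1) → ℝ × ℝ), (∀ i, p i ∈ mSupport γ) →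
    (⨆ i, |(p i).1 - (p i).2|) ≤ ⨆ i, |(p i).1 - (p (i + 1)).2|

/-- Points moved at maximal distance to the right. -/
def Mplus (γ : Measure (ℝ × ℝ)) (lam : ℝ) : Set ℝ := {x | (x, x + lam) ∈ mSupport γ}

/-- Points moved at maximal distance to the left. -/
def Mminus (γ : Measure (ℝ × ℝ)) (lam : ℝ) : Set ℝ := {x | (x, x - lam) ∈ mSupport γ}


theorem mSupport_eq_support {α : Type*} [TopologicalSpace α] [MeasurableSpace α]
    (γ : Measure α) : mSupport γ = γ.support := by
  rw [Measure.support_eq_forall_isOpen]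
  ext x
  exact ⟨fun h U hx hU => h U hU hx, fun h U hU hx => h U hx hU⟩

theorem ae_mem_mSupport (γ : Measure (ℝ × ℝ)) : ∀ᵐ p ∂γ, p ∈ mSupport γ := by
  rw [mSupport_eq_support]
  exact Measure.support_mem_ae

theorem abs_sub_le_of_mem_mSupport {γ : Measure (ℝ × ℝ)} {lam : ℝ}
    (h : ∀ᵐ p ∂γ, |p.1 - p.2| ≤ lam) {p : ℝ × ℝ} (hp : p ∈ mSupport γ) :
    |p.1 - p.2| ≤ lam := by
  have hclosed : IsClosed {p : ℝ × ℝ | |p.1 - p.2| ≤ lam} :=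
    isClosed_le (by fun_prop) continuous_const
  rw [mSupport_eq_support] at hp
  exact Measure.support_subset_of_isClosed hclosed h hp

/-- A finite chain for a relation, extracted as a sequence. -/
theorem exists_seq_of_reflTransGen {α : Type*} {r : α → α → Prop} {a b : α}
    (h : Relation.ReflTransGen r a b) :
    ∃ (n : ℕ) (f : ℕ → α), f 0 = a ∧ f n = b ∧ ∀ i < n, r (f i) (f (i + 1)) := by
  induction h with
  | refl => exact ⟨0, fun _ => a, rfl, rfl, by simp⟩
  | @tail b c _ hbc ih =>
    obtain ⟨n, f, h0, hn, hf⟩ := ih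
    refine ⟨n + 1, fun i => if i ≤ n then f i else c, by simpa using h0, by simp, ?_⟩
    intro i hi
    rcases Nat.lt_succ_iff_lt_or_eq.mp hi with hi' | rfl
    · have h1 : i ≤ n := hi'.le
      have h2 : i + 1 ≤ n := hi'
      simpa [h1, h2] using hf i hi'
    · simpa [hn] using hbc

/-- One step of a chain in the support of `γ` with transverse distance less than `lam`. -/
def ChainStep (γ : Measure (ℝ × ℝ)) (lam : ℝ) (p q : ℝ × ℝ) : Prop :=
  q ∈ mSupport γ ∧ |p.1 - q.2| < lam

/-- A chain starting at a pair at distance at least `lam` cannot be closed up with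
distances less than `lam`. -/
theorem InfCM.le_abs_sub_of_chain {γ : Measure (ℝ × ℝ)} (hcm : InfCM γ) {lam : ℝ}
    {p q : ℝ × ℝ} (hp : p ∈ mSupport γ) (hlam : lam ≤ |p.1 - p.2|)
    (h : Relation.ReflTransGen (ChainStep γ lam) p q) : lam ≤ |q.1 - p.2| := by
  by_contra! hlt
  obtain ⟨n, f, h0, hn, hf⟩ := exists_seq_of_reflTransGen h
  have hmem : ∀ i : Fin (n + 1), f i ∈ mSupport γ := by
    rintro ⟨i, hi⟩
    cases i with
    | zero => simpa [h0] using hp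
    | succ i => exact (hf i (by omega)).1
  have key := hcm n (fun i => f i) hmem
  obtain ⟨i, hi⟩ := exists_eq_ciSup_of_finite
    (f := fun i : Fin (n + 1) => |(f i).1 - (f ((i + 1 : Fin (n + 1)) : ℕ)).2|)
  have hlow : lam ≤ ⨆ i : Fin (n + 1), |(f i).1 - (f i).2| := by
    refine le_trans ?_ (le_ciSup (Set.finite_range _).bddAbove (0 : Fin (n + 1)))
    simpa [h0] using hlam
  have hup : |(f i).1 - (f ((i + 1 : Fin (n + 1)) : ℕ)).2| < lam := by
    refine Fin.lastCases ?_ (fun j => ?_) i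
    · simpa [h0, hn] using hlt
    · have := (hf j j.2).2
      rw [Fin.coeSucc_eq_succ]
      simpa using this
  exact absurd (hlow.trans key) (by rw [← hi]; exact hup.not_ge)

theorem fst_le_of_chain {γ : Measure (ℝ × ℝ)} (hcm : InfCM γ) {lam : ℝ}
    (hγ : ∀ᵐ p ∂γ, |p.1 - p.2| ≤ lam) {x : ℝ} (hx : x ∈ Mplus γ lam)
    {q : ℝ × ℝ} (h : Relation.ReflTransGen (ChainStep γ lam) (x, x + lam) q) :
    q.1 ≤ x := by
  induction h with
  | refl => exact le_rfl
  | @tail b c hb hbc ih =>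
    by_contra! hlt
    have hclose := hcm.le_abs_sub_of_chain hx (by simp [le_abs_self]) (hb.tail hbc)
    have h1 := abs_lt.mp hbc.2
    have h2 := abs_le.mp (abs_sub_le_of_mem_mSupport hγ hbc.1)
    refine hclose.not_gt (abs_lt.mpr ⟨?_, ?_⟩) <;> simp only <;> linarith [h1.1, h2.2]

theorem nhdsWithin_inter_Iio_eq_bot {s : Set ℝ} {a x : ℝ} (ha : a < x)
    (h : ∀ z ∈ s, a < z → z < x → False) : 𝓝[s ∩ Iio x] x = ⊥ := by
  rw [← Filter.empty_mem_iff_bot, mem_nhdsWithin]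
  exact ⟨Ioi a, isOpen_Ioi, ha, fun z hz => h z hz.2.1 hz.1 hz.2.2⟩

theorem nhdsWithin_inter_Ioi_eq_bot {s : Set ℝ} {a x : ℝ} (ha : x < a)
    (h : ∀ z ∈ s, x < z → z < a → False) : 𝓝[s ∩ Ioi x] x = ⊥ := by
  rw [← Filter.empty_mem_iff_bot, mem_nhdsWithin]
  exact ⟨Iio a, isOpen_Iio, ha, fun z hz => h z hz.2.1 hz.2.2 hz.1⟩

/-- The points outside `U` at distance at most `lam` from the center of an open interval of
radius `lam` contained in `U` form a countable set. -/
theorem countable_setOf_mem_closedBall_diff (U : Set ℝ) {lam : ℝ} (hlam : 0 < lam) :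
    {y | y ∉ U ∧ ∃ x, Metric.ball x lam ⊆ U ∧ |x - y| ≤ lam}.Countable := by
  refine ((countable_setOfPred_isolated_left_within (s := Uᶜ)).union
    (countable_setOfPred_isolated_right_within (s := Uᶜ))).mono ?_
  rintro y ⟨hy, x, hxU, hxy⟩
  have hball : ∀ z ∈ Uᶜ, ¬ |z - x| < lam := fun z hz hzx => hz (hxU (by
    rwa [Metric.mem_ball, Real.dist_eq]))
  have hne := hball y hy
  rw [abs_lt] at hne
  have hle := abs_le.mp hxy
  rcases le_total x y with h | h
  · have : y = x + lam := by
      by_contra hne'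
      exact hne ⟨by linarith, by
        have := lt_of_le_of_ne (show y ≤ x + lam by linarith) hne'
        linarith⟩
    refine Or.inl ⟨hy, nhdsWithin_inter_Iio_eq_bot (a := x - lam) (by linarith) ?_⟩
    exact fun z hz h1 h2 => hball z hz (abs_lt.mpr ⟨by linarith, by linarith⟩)
  · have : y = x - lam := by
      by_contra hne'
      exact hne ⟨by
        have := lt_of_le_of_ne (show x - lam ≤ y by linarith) (Ne.symm hne')
        linarith, by linarith⟩
    refine Or.inr ⟨hy, nhdsWithin_inter_Ioi_eq_bot (a := x + lam) (by linarith) ?_⟩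
    exact fun z hz h1 h2 => hball z hz (abs_lt.mpr ⟨by linarith, by linarith⟩)

section Plans

variable {γ γbar : Measure (ℝ × ℝ)} {lam : ℝ}

/-- If `γbar` transports into `U` only points whose `lam`-ball lies in `U`, then so does every
plan `γ` with the same marginals and cost at most `lam`. -/
theorem ae_ball_subset_of_ae_ball_subset [IsFiniteMeasure γ] [NullSingletonClass γ.snd]
    (hfst : γbar.fst = γ.fst) (hsnd : γbar.snd = γ.snd)
    (hγ : ∀ᵐ p ∂γ, |p.1 - p.2| ≤ lam) (hlam : 0 < lam) {U : Set ℝ} (hU : IsOpen U)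
    (h : ∀ᵐ p ∂γbar, p.2 ∈ U → Metric.ball p.1 lam ⊆ U) :
    ∀ᵐ p ∂γ, p.2 ∈ U → Metric.ball p.1 lam ⊆ U := by
  set A : Set ℝ := {x | Metric.ball x lam ⊆ U} with hA
  have hAclosed : IsClosed A := by
    have : A = ⋂ z ∈ Uᶜ, {x | lam ≤ dist z x} := by
      ext x
      simp only [hA, mem_ofPred_eq, mem_iInter, mem_compl_iff, Set.subset_def, Metric.mem_ball]
      exact forall_congr' fun z => by rw [← not_lt, not_imp_not]
    rw [this]
    exact isClosed_biInter fun z _ => isClosed_le continuous_const (by fun_prop)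
  have hle : γ.snd U ≤ γ.fst A := by
    rw [← hfst, ← hsnd, Measure.fst_apply hAclosed.measurableSet,
      Measure.snd_apply hU.measurableSet]
    exact measure_mono_ae h
  have hsub : (Prod.fst ⁻¹' A : Set (ℝ × ℝ)) ≤ᵐ[γ] (Prod.snd ⁻¹' U : Set (ℝ × ℝ)) := by
    have hnull : ∀ᵐ p ∂γ, p.2 ∉ {y | y ∉ U ∧ ∃ x, Metric.ball x lam ⊆ U ∧ |x - y| ≤ lam} :=
      ae_of_ae_map (f := Prod.snd) measurable_snd.aemeasurable
        (measure_eq_zero_iff_ae_notMem.mp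
          ((countable_setOf_mem_closedBall_diff U hlam).measure_zero γ.snd))
    filter_upwards [hγ, hnull] with p hp hpn hpA
    by_contra hpU
    exact hpn ⟨hpU, p.1, hpA, hp⟩
  rw [Measure.fst_apply hAclosed.measurableSet, Measure.snd_apply hU.measurableSet] at hle
  have heq := ae_eq_of_ae_subset_of_measure_ge hsub hle
    (measurable_fst hAclosed.measurableSet).nullMeasurableSet (measure_ne_top _ _)
  filter_upwards [heq.symm.le] with p hp using hp

theorem measure_Ioi_prod_Ioo_eq_zero [IsFiniteMeasure γ] [NullSingletonClass γ.snd]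
    (hfst : γbar.fst = γ.fst) (hsnd : γbar.snd = γ.snd)
    (hγ : ∀ᵐ p ∂γ, |p.1 - p.2| ≤ lam) (hγbar : ∀ᵐ p ∂γbar, |p.1 - p.2| ≤ lam)
    (hcm : InfCM γbar) (hlam : 0 < lam) {x : ℝ} (hx : x ∈ Mplus γbar lam) :
    γ (Ioi x ×ˢ Ioo (x - lam) (x + lam)) = 0 := by
  set R : Set (ℝ × ℝ) :=
    {q | Relation.ReflTransGen (ChainStep γbar lam) (x, x + lam) q} with hR
  set U : Set ℝ := ⋃ q ∈ R, Metric.ball q.1 lam with hU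
  have hUopen : IsOpen U := isOpen_biUnion fun _ _ => Metric.isOpen_ball
  have hae := ae_ball_subset_of_ae_ball_subset hfst hsnd hγ hlam hUopen (by
    filter_upwards [ae_mem_mSupport γbar] with p hp hpU
    obtain ⟨q, hq, hpq⟩ := mem_iUnion₂.mp hpU
    rw [Metric.mem_ball, dist_comm, Real.dist_eq] at hpq
    exact subset_biUnion_of_mem (u := fun q : ℝ × ℝ => Metric.ball q.1 lam)
      (show p ∈ R from hq.tail ⟨hp, hpq⟩))
  rw [measure_eq_zero_iff_ae_notMem]
  filter_upwards [hae] with p hp hmem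
  obtain ⟨h1, h2⟩ := hmem
  rw [mem_Ioi] at h1
  rw [Real.Ioo_eq_ball] at h2
  have hpU : p.2 ∈ U := by
    refine mem_iUnion₂.mpr ⟨(x, x + lam), Relation.ReflTransGen.refl, ?_⟩
    convert! h2 using 2 <;> ring
  have hz : p.1 + lam - min (lam / 2) ((p.1 - x) / 2) ∈ U := by
    apply hp hpU
    have hpos : 0 < min (lam / 2) ((p.1 - x) / 2) := lt_min (by linarith) (by linarith)
    have hle := min_le_left (lam / 2) ((p.1 - x) / 2)
    rw [Metric.mem_ball, Real.dist_eq, abs_lt]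
    constructor <;> linarith
  obtain ⟨q, hq, hzq⟩ := mem_iUnion₂.mp hz
  have hqx := fst_le_of_chain hcm hγbar hx hq
  rw [Metric.mem_ball, Real.dist_eq, abs_lt] at hzq
  have hle := min_le_right (lam / 2) ((p.1 - x) / 2)
  linarith [hzq.2]

theorem measure_Mplus_off_line_eq_zero [IsFiniteMeasure γ] [NullSingletonClass γ.fst]
    [NullSingletonClass γ.snd] (hfst : γbar.fst = γ.fst) (hsnd : γbar.snd = γ.snd)
    (hγ : ∀ᵐ p ∂γ, |p.1 - p.2| ≤ lam) (hγbar : ∀ᵐ p ∂γbar, |p.1 - p.2| ≤ lam)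
    (hcm : InfCM γbar) :
    γ {p : ℝ × ℝ | p.1 ∈ Mplus γbar lam ∧ p.2 ≠ p.1 + lam} = 0 := by
  have hiso : ∀ᵐ p ∂γ,
      p.1 ∉ {x | x ∈ Mplus γbar lam ∧ 𝓝[Mplus γbar lam ∩ Iio x] x = ⊥} :=
    ae_of_ae_map (f := Prod.fst) measurable_fst.aemeasurable
      (measure_eq_zero_iff_ae_notMem.mp
        (countable_setOfPred_isolated_left_within.measure_zero γ.fst))
  rw [measure_eq_zero_iff_ae_notMem]
  filter_upwards [hγ, hiso, ae_mem_mSupport γ] with p hp hpiso hpsupp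
  rintro ⟨hpM, hpne⟩
  have hp' := abs_le.mp hp
  have hlt : p.2 < p.1 + lam := lt_of_le_of_ne (by linarith) hpne
  have hlam : 0 < lam := by linarith
  refine hpiso ⟨hpM, nhdsWithin_inter_Iio_eq_bot (a := p.2 - lam) (by linarith) ?_⟩
  intro x hx h1 h2
  refine (hpsupp _ (isOpen_Ioi.prod isOpen_Ioo) ?_).ne'
    (measure_Ioi_prod_Ioo_eq_zero hfst hsnd hγ hγbar hcm hlam hx)
  exact ⟨h2, by linarith, by linarith⟩

end Plans

section Reflection

variable (γ : Measure (ℝ × ℝ))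

theorem mem_mSupport_map_neg {p : ℝ × ℝ} : p ∈ mSupport (γ.map Neg.neg) ↔ -p ∈ mSupport γ := by
  constructor
  · intro h U hU hp
    have := h (Neg.neg ⁻¹' U) (hU.preimage continuous_neg) hp
    rwa [Measure.map_apply measurable_neg (hU.preimage continuous_neg).measurableSet,
      ← preimage_comp, neg_comp_neg, preimage_id] at this
  · intro h U hU hp
    rw [Measure.map_apply measurable_neg hU.measurableSet]
    exact h _ (hU.preimage continuous_neg) (by simpa using hp)

theorem fst_map_neg : (γ.map Neg.neg).fst = γ.fst.map Neg.neg := by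
  rw [Measure.fst, Measure.fst, Measure.map_map measurable_fst measurable_neg,
    Measure.map_map measurable_neg measurable_fst]
  rfl

theorem snd_map_neg : (γ.map Neg.neg).snd = γ.snd.map Neg.neg := by
  rw [Measure.snd, Measure.snd, Measure.map_map measurable_snd measurable_neg,
    Measure.map_map measurable_neg measurable_snd]
  rfl

theorem nullSingletonClass_map_neg (μ : Measure ℝ) [NullSingletonClass μ] :
    NullSingletonClass (μ.map Neg.neg) where
  measure_singleton x := by
    rw [Measure.map_apply measurable_neg (measurableSet_singleton x)]
    simp

theorem ae_abs_sub_le_map_neg {γ : Measure (ℝ × ℝ)} {lam : ℝ}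
    (h : ∀ᵐ p ∂γ, |p.1 - p.2| ≤ lam) : ∀ᵐ p ∂γ.map Neg.neg, |p.1 - p.2| ≤ lam := by
  rw [ae_map_iff measurable_neg.aemeasurable (measurableSet_le (by fun_prop) measurable_const)]
  filter_upwards [h] with p hp
  rwa [Prod.fst_neg, Prod.snd_neg, neg_sub_neg, abs_sub_comm]

variable {γ} in
theorem InfCM.map_neg (h : InfCM γ) : InfCM (γ.map Neg.neg) := by
  intro n p hp
  have := h n (fun i => -p i) fun i => (mem_mSupport_map_neg γ).mp (hp i)
  simpa only [Prod.fst_neg, Prod.snd_neg, neg_sub_neg, abs_sub_comm] using this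

theorem mem_Mplus_map_neg {lam x : ℝ} : x ∈ Mplus (γ.map Neg.neg) lam ↔ -x ∈ Mminus γ lam := by
  rw [Mplus, Mminus, mem_ofPred_eq, mem_ofPred_eq, mem_mSupport_map_neg]
  rw [Prod.neg_mk, neg_add, ← sub_eq_add_neg]

end Reflection

theorem measure_Mminus_off_line_eq_zero {γ γbar : Measure (ℝ × ℝ)} {lam : ℝ}
    [IsFiniteMeasure γ] [NullSingletonClass γ.fst]
    [NullSingletonClass γ.snd] (hfst : γbar.fst = γ.fst) (hsnd : γbar.snd = γ.snd)
    (hγ : ∀ᵐ p ∂γ, |p.1 - p.2| ≤ lam) (hγbar : ∀ᵐ p ∂γbar, |p.1 - p.2| ≤ lam)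
    (hcm : InfCM γbar) :
    γ {p : ℝ × ℝ | p.1 ∈ Mminus γbar lam ∧ p.2 ≠ p.1 - lam} = 0 := by
  have : NullSingletonClass (γ.map Neg.neg).fst := by
    rw [fst_map_neg]; exact nullSingletonClass_map_neg _
  have : NullSingletonClass (γ.map Neg.neg).snd := by
    rw [snd_map_neg]; exact nullSingletonClass_map_neg _
  have key := measure_Mplus_off_line_eq_zero (γ := γ.map Neg.neg) (γbar := γbar.map Neg.neg)
    (by rw [fst_map_neg, fst_map_neg, hfst]) (by rw [snd_map_neg, snd_map_neg, hsnd])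
    (ae_abs_sub_le_map_neg hγ) (ae_abs_sub_le_map_neg hγbar) hcm.map_neg
  rw [measure_eq_zero_iff_ae_notMem] at key ⊢
  filter_upwards [ae_of_ae_map measurable_neg.aemeasurable key] with p hp
  rintro ⟨h1, h2⟩
  refine hp ⟨(mem_Mplus_map_neg γbar).mpr (by simpa using h1), fun h => h2 ?_⟩
  rw [Prod.fst_neg, Prod.snd_neg] at h
  linarith

theorem costInf_lt_top_of_compactlySupported {μ ν : Measure ℝ} (hμ : CompactlySupported μ)
    (hν : CompactlySupported ν) {γ : Measure (ℝ × ℝ)} (hγ : IsCoupling μ ν γ) :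
    costInf γ < ∞ := by
  obtain ⟨K, hK, hK0⟩ := hμ
  obtain ⟨L, hL, hL0⟩ := hν
  have h1 : ∀ᵐ p ∂γ, p.1 ∈ K :=
    ae_of_ae_map (f := Prod.fst) measurable_fst.aemeasurable (by rw [← Measure.fst, hγ.1]; exact hK0)
  have h2 : ∀ᵐ p ∂γ, p.2 ∈ L :=
    ae_of_ae_map (f := Prod.snd) measurable_snd.aemeasurable (by rw [← Measure.snd, hγ.2]; exact hL0)
  have hdiam : Metric.ediam (K ∪ L) < ∞ :=
    (Metric.isBounded_iff_ediam_ne_top.mp (hK.union hL).isBounded).lt_top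
  refine lt_of_le_of_lt (essSup_le_of_ae_le _ ?_) hdiam
  filter_upwards [h1, h2] with p hp1 hp2
  exact Metric.edist_le_ediam_of_mem (Or.inl hp1) (Or.inr hp2)

theorem IsOptimalPlan.ae_abs_sub_le {μ ν : Measure ℝ} {γ : Measure (ℝ × ℝ)}
    (hγ : IsOptimalPlan μ ν γ) (hfin : Winfty μ ν ≠ ∞) :
    ∀ᵐ p ∂γ, |p.1 - p.2| ≤ (Winfty μ ν).toReal := by
  filter_upwards [ENNReal.ae_le_essSup (μ := γ) (fun p : ℝ × ℝ => edist p.1 p.2)] with p hp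
  have hp' : edist p.1 p.2 ≤ Winfty μ ν := hγ.2 ▸ hp
  rw [← Real.dist_eq, dist_edist]
  exact ENNReal.toReal_mono hfin hp'

/-- Any optimal plan γ coincides on M_γ̄⁺ (resp. M_γ̄⁻) with the translation by +λ_C
(resp. −λ_C): the restriction of γ to M_γ̄⁺ × ℝ is concentrated on the line
{y = x + λ_C}, and similarly for M_γ̄⁻. -/
theorem optimal_plan_rigid_on_maximal_set (μ ν : Measure ℝ)
    [IsProbabilityMeasure μ] [IsProbabilityMeasure ν] [NullSingletonClass μ] [NullSingletonClass ν]
    (hμ : CompactlySupported μ) (hν : CompactlySupported ν)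
    (γ γbar : Measure (ℝ × ℝ)) (hγ : IsOptimalPlan μ ν γ)
    (hγbar : IsOptimalPlan μ ν γbar) (hcm : InfCM γbar) :
    γ {p : ℝ × ℝ | p.1 ∈ Mplus γbar (Winfty μ ν).toReal ∧
        p.2 ≠ p.1 + (Winfty μ ν).toReal} = 0 ∧
    γ {p : ℝ × ℝ | p.1 ∈ Mminus γbar (Winfty μ ν).toReal ∧
        p.2 ≠ p.1 - (Winfty μ ν).toReal} = 0 := by
  have hfin : Winfty μ ν ≠ ∞ :=
    hγ.2 ▸ (costInf_lt_top_of_compactlySupported hμ hν hγ.1).ne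
  have hfst : γbar.fst = γ.fst := hγbar.1.1.trans hγ.1.1.symm
  have hsnd : γbar.snd = γ.snd := hγbar.1.2.trans hγ.1.2.symm
  have : NullSingletonClass γ.fst := hγ.1.1.symm ▸ ‹NullSingletonClass μ›
  have : NullSingletonClass γ.snd := hγ.1.2.symm ▸ ‹NullSingletonClass ν›
  have : IsFiniteMeasure γ :=
    ⟨by rw [← Measure.fst_univ, hγ.1.1]; exact measure_lt_top μ _⟩
  exact ⟨measure_Mplus_off_line_eq_zero hfst hsnd (hγ.ae_abs_sub_le hfin)
      (hγbar.ae_abs_sub_le hfin) hcm,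
    measure_Mminus_off_line_eq_zero hfst hsnd (hγ.ae_abs_sub_le hfin)
      (hγbar.ae_abs_sub_le hfin) hcm⟩

end
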